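/- Let c > 1 be a real number. Then ∫₀¹ (1−t)^c ( ∫_c^{c/(1−t)} (x − c − c·ln(x/c)) dx ) dt = 1/(c²−1). -/

import Mathlib

open MeasureTheory intervalIntegral Real

/-- Logarithmic moment of a real power on the unit interval. -/
lemma integral_rpow_sub_one_mul_log {c : ℝ} (hc : 1 ≤ c) :
    IntervalIntegrable (fun s : ℝ => s ^ (c - 1) * log s) volume 0 1 ∧
    ∫ s in (0:ℝ)..1, s ^ (c - 1) * log s = -1 / c ^ 2 := by
  have hc0 : c ≠ 0 := by positivity
  have hcont : Continuous fun s : ℝ => s ^ (c - 1) :=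
    continuous_id.rpow_const fun _ => Or.inr (by linarith)
  have hint : IntervalIntegrable (fun s : ℝ => s ^ (c - 1) * log s) volume 0 1 :=
    intervalIntegrable_log'.continuousOn_mul hcont.continuousOn
  refine ⟨hint, ?_⟩
  have hderiv : ∀ s ∈ Set.Ioo (0:ℝ) 1,
      HasDerivAt (fun s : ℝ => s ^ (c - 1) * (s * log s) / c - s ^ (c - 1) * s / c ^ 2)
        (s ^ (c - 1) * log s) s := by
    intro s hs
    have hs0 : s ≠ 0 := hs.1.ne'
    have hp : HasDerivAt (fun s : ℝ => s ^ (c - 1)) ((c - 1) * s ^ (c - 1 - 1)) s :=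
      hasDerivAt_rpow_const (Or.inl hs0)
    refine (((hp.mul (hasDerivAt_mul_log hs0)).div_const c).sub
      ((hp.mul (hasDerivAt_id s)).div_const (c ^ 2))).congr_deriv ?_
    rw [rpow_sub_one hs0 (c - 1)]
    simp only [id]
    field_simp
    ring
  rw [integral_eq_sub_of_hasDerivAt_of_le zero_le_one ?_ hderiv hint]
  · simp [neg_div]
  · exact (((hcont.mul continuous_mul_log).div_const c).sub
      ((hcont.mul continuous_id).div_const (c ^ 2))).continuousOn

/-- The integral of the linearization error of `c * log (x / c)` over `[c, c / s]`. -/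
lemma integral_sub_sub_mul_log_div {c s : ℝ} (hc : 0 < c) (hs : 0 < s) :
    ∫ x in c..(c / s), (x - c - c * log (x / c)) =
      c ^ 2 * (1 / (2 * s ^ 2) + log s / s - 1 / 2) := by
  have hpos : ∀ x ∈ Set.uIcc c (c / s), 0 < x := fun x hx =>
    (lt_min hc (div_pos hc hs)).trans_le hx.1
  rw [integral_eq_sub_of_hasDerivAt (f := fun x => x ^ 2 / 2 - c * x * log (x / c))]
  · have h1 : c / s / c = s⁻¹ := by field_simp
    rw [h1, div_self hc.ne', log_inv, log_one]
    field_simp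
    ring
  · intro x hx
    have hx0 := hpos x hx
    refine (((hasDerivAt_pow 2 x).div_const 2).sub
      (((hasDerivAt_id x).const_mul c).mul
        (((hasDerivAt_id x).div_const c).log (div_pos hx0 hc).ne'))).congr_deriv ?_
    simp only [id, Nat.cast_ofNat, Nat.add_one_sub_one, pow_one]
    field_simp
    ring
  · refine ContinuousOn.intervalIntegrable ?_
    refine (continuousOn_id.sub continuousOn_const).sub (continuousOn_const.mul ?_)
    exact (continuousOn_id.div_const c).log fun x hx => (div_pos (hpos x hx) hc).ne'

/-- Second component of the expected rank of the memoryless threshold rule: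
`∫₀¹ (1-t)^c (∫_c^{c/(1-t)} (x - c - c ln(x/c)) dx) dt = 1/(c² - 1)`. -/
theorem expected_rank_threshold_second_component (c : ℝ) (hc : 1 < c) :
    (∫ t in (0:ℝ)..1, (1 - t) ^ c *
      (∫ x in c..(c / (1 - t)), (x - c - c * Real.log (x / c)))) =
    1 / (c ^ 2 - 1) := by
  have hc0 : 0 < c := by linarith
  rw [integral_comp_sub_left
    (fun s : ℝ => s ^ c * ∫ x in c..(c / s), (x - c - c * log (x / c))) 1, sub_self, sub_zero]
  have hcongr : ∀ s ∈ Set.uIoc (0:ℝ) 1,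
      s ^ c * ∫ x in c..(c / s), (x - c - c * log (x / c)) =
        c ^ 2 * (s ^ (c - 2) / 2 + s ^ (c - 1) * log s - s ^ c / 2) := by
    intro s hs
    rw [Set.uIoc_of_le zero_le_one] at hs
    rw [integral_sub_sub_mul_log_div hc0 hs.1, rpow_sub_one hs.1.ne', rpow_sub hs.1, rpow_two]
    field_simp
  obtain ⟨hint, hlog⟩ := integral_rpow_sub_one_mul_log hc.le
  have h1 : IntervalIntegrable (fun s : ℝ => s ^ (c - 2) / 2) volume 0 1 :=
    (intervalIntegrable_rpow' (by linarith)).div_const 2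
  have h2 : IntervalIntegrable (fun s : ℝ => s ^ c / 2) volume 0 1 :=
    (intervalIntegrable_rpow' (by linarith)).div_const 2
  have e1 : 0 < c - 1 := by linarith
  have e2 : 0 < c + 1 := by linarith
  have e3 : c - 2 + 1 = c - 1 := by ring
  rw [integral_congr_ae (.of_forall hcongr), intervalIntegral.integral_const_mul,
    intervalIntegral.integral_sub (h1.add hint) h2, intervalIntegral.integral_add h1 hint, hlog,
    intervalIntegral.integral_div, intervalIntegral.integral_div,
    integral_rpow (Or.inl (by linarith)), integral_rpow (Or.inl (by linarith)), e3,
    one_rpow, one_rpow, zero_rpow e1.ne', zero_rpow e2.ne',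
    show c ^ 2 - 1 = (c - 1) * (c + 1) by ring]
  field_simp
  ring
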